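/- Let V be a finite vertex type, w an edge-weight function taking values in (0, ∞], goal ∈ V, and lmc : V → ℝ≥0∞ satisfying lmc(goal) = 0 and, for every v ≠ goal, the Bellman fixed-point equation lmc(v) = min over u ∈ V, u ≠ v, of (w(v,u) + lmc(u)). Then lmc(v) = d_w(v, goal) for every v ∈ V. -/

import Mathlib

open scoped ENNReal

/-- The cost of a path (a finite list of vertices) under an edge-weight
function `w`: the sum of `w vᵢ vᵢ₊₁` over consecutive pairs. -/
noncomputable def pathCost {V : Type*} (w : V → V → ℝ≥0∞) (π : List V) : ℝ≥0∞ :=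
  ((π.zip π.tail).map fun p => w p.1 p.2).sum

/-- `π` is a path from `s` to `t`: a nonempty finite list of vertices
starting at `s` and ending at `t`. -/
def IsPath {V : Type*} (s t : V) (π : List V) : Prop :=
  π.head? = some s ∧ π.getLast? = some t

/-- The distance from `s` to `t` under `w`: the infimum (in `ℝ≥0∞`) of the
costs of all paths from `s` to `t`. -/
noncomputable def graphDist {V : Type*} (w : V → V → ℝ≥0∞) (s t : V) : ℝ≥0∞ :=
  ⨅ π ∈ {π : List V | IsPath s t π}, pathCost w π

theorem pathCost_cons_cons {V : Type*} (w : V → V → ℝ≥0∞) (v u : V) (π : List V) :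
    pathCost w (v :: u :: π) = w v u + pathCost w (u :: π) := by
  simp [pathCost]

theorem IsPath.cons {V : Type*} {s t : V} {π : List V} (h : IsPath s t π) (v : V) :
    IsPath v t (v :: π) := by
  refine ⟨rfl, ?_⟩
  rw [List.getLast?_cons, h.2]
  rfl

theorem graphDist_self {V : Type*} (w : V → V → ℝ≥0∞) (v : V) : graphDist w v v = 0 :=
  le_antisymm ((iInf₂_le [v] (⟨rfl, rfl⟩ : IsPath v v [v])).trans (by simp [pathCost])) zero_le

theorem graphDist_le_add {V : Type*} (w : V → V → ℝ≥0∞) (v u t : V) :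
    graphDist w v t ≤ w v u + graphDist w u t := by
  simp only [graphDist, ENNReal.add_iInf]
  refine le_iInf₂ fun π hπ => (iInf₂_le (v :: π) (IsPath.cons hπ v)).trans ?_
  obtain ⟨ρ, rfl⟩ := List.head?_eq_some_iff.1 hπ.1
  exact (pathCost_cons_cons w v u ρ).le

/-- A potential vanishing at `t` and satisfying `f v ≤ w v u + f u` along every edge bounds
the cost of every path to `t` from below. -/
theorem le_graphDist {V : Type*} (w : V → V → ℝ≥0∞) {t : V} {f : V → ℝ≥0∞} (ht : f t = 0)
    (hf : ∀ v u, f v ≤ w v u + f u) (v : V) : f v ≤ graphDist w v t := by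
  refine le_iInf₂ fun π hπ => ?_
  obtain ⟨π, rfl⟩ := List.head?_eq_some_iff.1 hπ.1
  replace hπ := hπ.2
  induction π generalizing v with
  | nil =>
    obtain rfl : v = t := by simpa using hπ
    simp [ht]
  | cons u π ih =>
    rw [pathCost_cons_cons]
    exact (hf v u).trans (by gcongr; exact ih u (by simpa using hπ))

/-- with strictly positive edge weights, if `lmc goal = 0` and
every non-goal vertex satisfies the Bellman fixed-point equation
`lmc v = min_{u ≠ v} (w v u + lmc u)`, then `lmc v = d_w(v, goal)` for every
vertex `v`. -/
theorem bellman_fixed_point_eq_dist {V : Type*} [Fintype V]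
    (w : V → V → ℝ≥0∞) (hpos : ∀ u v : V, 0 < w u v)
    (goal : V) (lmc : V → ℝ≥0∞)
    (hgoal : lmc goal = 0)
    (hbellman : ∀ v : V, v ≠ goal →
      lmc v = ⨅ u ∈ {u : V | u ≠ v}, (w v u + lmc u)) :
    ∀ v : V, lmc v = graphDist w v goal := by
  intro v
  refine le_antisymm (le_graphDist w hgoal (fun v u => ?_) v) ?_
  · rcases eq_or_ne v goal with rfl | hv
    · simp [hgoal]
    rcases eq_or_ne u v with rfl | huv
    · exact le_add_self
    rw [hbellman v hv]
    exact iInf₂_le u huv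
  · have hwf : WellFounded fun a b : V => lmc a < lmc b :=
      @Finite.wellFounded_of_trans_of_irrefl V _ _ ⟨fun _ _ _ => lt_trans⟩ ⟨fun _ => lt_irrefl _⟩
    induction v using hwf.induction with
    | h v ih =>
      rcases eq_or_ne v goal with rfl | hv
      · simp [graphDist_self]
      rcases eq_or_ne (lmc v) ⊤ with htop | htop
      · simp [htop]
      have : Nonempty V := ⟨v⟩
      obtain ⟨u, hu⟩ := exists_eq_ciInf_of_finite
        (f := fun u => ⨅ _ : u ∈ {u : V | u ≠ v}, (w v u + lmc u))
      rw [← hbellman v hv] at hu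
      have huv : u ≠ v := by
        rintro rfl
        exact htop (by simpa using hu.symm)
      replace hu : w v u + lmc u = lmc v := by simpa [huv] using hu
      have hlt : lmc u < lmc v := by
        have hfin : lmc u ≠ ⊤ := fun h => htop (by rw [← hu, h, add_top])
        rw [← hu, add_comm]
        exact ENNReal.lt_add_right hfin (hpos v u).ne'
      calc graphDist w v goal ≤ w v u + graphDist w u goal := graphDist_le_add w v u goal
        _ ≤ w v u + lmc u := by gcongr; exact ih u hlt
        _ = lmc v := hu
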